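/- arXiv:1105.4533 — 2 statements merged into one kernel-verified Lean document; each statement's English description precedes it below -/
import Mathlib

section
/- There exists a numerical constant C ≥ 1 such that for every N ≥ 1 and every subset A ⊆ {-1,+1}^N, μ(A)(1 − μ(A)) ≤ C · Σ_{i=1}^N 2 I_i(A) / (1 + log(1/√(2 I_i(A)))), where summands with I_i(A) = 0 are interpreted as 0. -/
/-- Uniform probability measure of a subset of the discrete cube `{-1,+1}^N`,
modeled as `Fin N → Bool`. -/
noncomputable def cubeMeas (N : ℕ) (A : Finset (Fin N → Bool)) : ℝ :=
  (A.card : ℝ) / 2 ^ N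

/-- Influence of the `i`-th coordinate on `A`:
`I_i(A) = μ({x ∈ A : τ_i x ∉ A})` where `τ_i` flips the `i`-th coordinate. -/
noncomputable def cubeInfl (N : ℕ) (i : Fin N) (A : Finset (Fin N → Bool)) : ℝ :=
  ((A.filter fun x => Function.update x i (!x i) ∉ A).card : ℝ) / 2 ^ N

/-- Expectation of a function on the cube under the uniform measure. -/
noncomputable def cubeExp {N : ℕ} (f : (Fin N → Bool) → ℝ) : ℝ := (∑ x, f x) / 2 ^ N

/-- The sign attached to a bit. -/
def bitSign (b : Bool) : ℝ := if b then 1 else -1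

/-- The Walsh function indexed by `S`. -/
def walsh {N : ℕ} (S : Finset (Fin N)) (x : Fin N → Bool) : ℝ := ∏ i ∈ S, bitSign (x i)

/-- The Walsh coefficient of `f` at `S`. -/
noncomputable def walshCoeff {N : ℕ} (f : (Fin N → Bool) → ℝ) (S : Finset (Fin N)) : ℝ :=
  cubeExp fun x => f x * walsh S x

/-- The map flipping the `i`-th coordinate. -/
def flipAt {N : ℕ} (i : Fin N) (x : Fin N → Bool) : Fin N → Bool := Function.update x i (!x i)

section Expectation

variable {N : ℕ} (f g : (Fin N → Bool) → ℝ)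

theorem cubeExp_add : cubeExp (fun x => f x + g x) = cubeExp f + cubeExp g := by
  simp [cubeExp, Finset.sum_add_distrib, add_div]

theorem cubeExp_const_mul (c : ℝ) : cubeExp (fun x => c * f x) = c * cubeExp f := by
  simp [cubeExp, ← Finset.mul_sum, mul_div_assoc]

theorem cubeExp_sum {ι : Type*} (s : Finset ι) (F : ι → (Fin N → Bool) → ℝ) :
    cubeExp (fun x => ∑ j ∈ s, F j x) = ∑ j ∈ s, cubeExp (F j) := by
  simp only [cubeExp]
  rw [Finset.sum_comm, Finset.sum_div]

theorem cubeExp_nonneg (hf : ∀ x, 0 ≤ f x) : 0 ≤ cubeExp f :=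
  div_nonneg (Finset.sum_nonneg fun x _ => hf x) (by positivity)

theorem cubeExp_mul_sq_le :
    cubeExp (fun x => f x * g x) ^ 2 ≤ cubeExp (fun x => f x ^ 2) * cubeExp (fun x => g x ^ 2) := by
  simp only [cubeExp, div_pow, div_mul_div_comm, ← sq]
  gcongr
  exact Finset.sum_mul_sq_le_sq_mul_sq _ _ _

end Expectation

section Flip

variable {N : ℕ} (i : Fin N)

theorem flipAt_flipAt (x : Fin N → Bool) : flipAt i (flipAt i x) = x := by
  simp [flipAt]

theorem cubeExp_comp_flipAt (f : (Fin N → Bool) → ℝ) :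
    cubeExp (fun x => f (flipAt i x)) = cubeExp f := by
  unfold cubeExp
  congr 1
  exact Equiv.sum_comp (Function.Involutive.toPerm (flipAt i) (flipAt_flipAt i)) f

theorem bitSign_sq (b : Bool) : bitSign b ^ 2 = 1 := by
  cases b <;> simp [bitSign]

theorem bitSign_flipAt (x : Fin N → Bool) : bitSign (flipAt i x i) = -bitSign (x i) := by
  cases h : x i <;> simp [bitSign, flipAt, h]

theorem walsh_flipAt_of_notMem {S : Finset (Fin N)} (hi : i ∉ S) (x : Fin N → Bool) :
    walsh S (flipAt i x) = walsh S x := by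
  refine Finset.prod_congr rfl fun j hj => ?_
  have : j ≠ i := fun h => hi (h ▸ hj)
  simp [flipAt, this]

theorem walsh_insert {S : Finset (Fin N)} (hi : i ∉ S) (x : Fin N → Bool) :
    walsh (insert i S) x = bitSign (x i) * walsh S x :=
  Finset.prod_insert hi

theorem walsh_flipAt_of_mem {S : Finset (Fin N)} (hi : i ∈ S) (x : Fin N → Bool) :
    walsh S (flipAt i x) = -walsh S x := by
  rw [← Finset.insert_erase hi, walsh_insert i (Finset.notMem_erase i S),
    walsh_insert i (Finset.notMem_erase i S),
    walsh_flipAt_of_notMem i (Finset.notMem_erase i S), bitSign_flipAt, neg_mul]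

theorem cubeExp_bitSign_mul (f : (Fin N → Bool) → ℝ) (hf : ∀ x, f (flipAt i x) = f x) :
    cubeExp (fun x => bitSign (x i) * f x) = 0 := by
  have h := cubeExp_comp_flipAt i fun x => bitSign (x i) * f x
  have h' : (fun x => bitSign (flipAt i x i) * f (flipAt i x)) =
      fun x => (-1) * (bitSign (x i) * f x) := by
    funext x
    rw [bitSign_flipAt, hf]
    ring
  rw [h', cubeExp_const_mul] at h
  linarith

end Flip

section Fourier

variable {N : ℕ}

theorem sum_walsh_mul_walsh (x y : Fin N → Bool) :
    ∑ S : Finset (Fin N), walsh S x * walsh S y = if x = y then 2 ^ N else 0 := by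
  have h : ∑ S : Finset (Fin N), walsh S x * walsh S y =
      ∏ i, (1 + bitSign (x i) * bitSign (y i)) := by
    rw [Finset.prod_one_add, Finset.powerset_univ]
    exact Finset.sum_congr rfl fun S _ => Finset.prod_mul_distrib.symm
  rw [h]
  split_ifs with hxy
  · subst hxy
    simp only [← sq, bitSign_sq]
    norm_num
  · obtain ⟨i, hi⟩ := Function.ne_iff.1 hxy
    refine Finset.prod_eq_zero (Finset.mem_univ i) ?_
    cases hx : x i <;> cases hy : y i <;> simp_all [bitSign]

theorem sum_walshCoeff_sq (f : (Fin N → Bool) → ℝ) :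
    ∑ S, walshCoeff f S ^ 2 = cubeExp fun x => f x ^ 2 := by
  have h : ∀ S, walshCoeff f S ^ 2 =
      (∑ x, ∑ y, f x * f y * (walsh S x * walsh S y)) / (2 ^ N * 2 ^ N) := by
    intro S
    rw [sq, walshCoeff, cubeExp, div_mul_div_comm, Finset.sum_mul_sum]
    congr 1
    exact Finset.sum_congr rfl fun x _ => Finset.sum_congr rfl fun y _ => by ring
  simp only [h]
  rw [← Finset.sum_div, Finset.sum_comm]
  have h' : ∀ x, ∑ S : Finset (Fin N), ∑ y, f x * f y * (walsh S x * walsh S y) =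
      2 ^ N * f x ^ 2 := by
    intro x
    rw [Finset.sum_comm]
    simp only [← Finset.mul_sum, sum_walsh_mul_walsh]
    simp
    ring
  simp only [h', ← Finset.mul_sum]
  rw [cubeExp, mul_div_mul_left _ _ (by positivity)]

/-- The discrete derivative of `f` in direction `i`. -/
def flipDiff (i : Fin N) (f : (Fin N → Bool) → ℝ) (x : Fin N → Bool) : ℝ := f x - f (flipAt i x)

theorem walshCoeff_flipDiff (i : Fin N) (f : (Fin N → Bool) → ℝ) (S : Finset (Fin N)) :
    walshCoeff (flipDiff i f) S = if i ∈ S then 2 * walshCoeff f S else 0 := by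
  have h : walshCoeff (flipDiff i f) S =
      walshCoeff f S + (-1) * cubeExp fun x => f (flipAt i x) * walsh S x := by
    rw [walshCoeff, walshCoeff, ← cubeExp_const_mul, ← cubeExp_add]
    congr 1
    funext x
    rw [flipDiff]
    ring
  have h' : cubeExp (fun x => f (flipAt i x) * walsh S x) =
      cubeExp fun x => f x * walsh S (flipAt i x) := by
    rw [← cubeExp_comp_flipAt i]
    simp only [flipAt_flipAt]
  rw [h, h']
  split_ifs with hi
  · simp only [walsh_flipAt_of_mem i hi]
    rw [walshCoeff, ← cubeExp_const_mul, ← cubeExp_const_mul, ← cubeExp_add]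
    congr 1
    funext x
    ring
  · simp only [walsh_flipAt_of_notMem i hi]
    rw [walshCoeff]
    ring

/-- Bonami's fourth moment inequality. -/
theorem cubeExp_walsh_sum_pow_four_le (s : Finset (Fin N)) (a : Finset (Fin N) → ℝ) :
    cubeExp (fun x => (∑ S ∈ s.powerset, a S * walsh S x) ^ 4) ≤
      (∑ S ∈ s.powerset, 3 ^ S.card * a S ^ 2) ^ 2 := by
  induction s using Finset.induction_on generalizing a with
  | empty =>
    simp [walsh, cubeExp, ← pow_mul]
  | insert i s hi ih =>
    set F : (Fin N → Bool) → ℝ := fun x => ∑ S ∈ s.powerset, a S * walsh S x with hF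
    set G : (Fin N → Bool) → ℝ := fun x => ∑ S ∈ s.powerset, a (insert i S) * walsh S x with hG
    set A := ∑ S ∈ s.powerset, 3 ^ S.card * a S ^ 2 with hA
    set B := ∑ S ∈ s.powerset, 3 ^ S.card * a (insert i S) ^ 2 with hB
    have hnot : ∀ S ∈ s.powerset, i ∉ S := fun S hS h => hi (Finset.mem_powerset.1 hS h)
    have hFG : ∀ x, ∑ S ∈ (insert i s).powerset, a S * walsh S x = F x + bitSign (x i) * G x := by
      intro x
      rw [Finset.sum_powerset_insert hi, hF, hG, Finset.mul_sum]
      congr 1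
      refine Finset.sum_congr rfl fun S hS => ?_
      rw [walsh_insert i (hnot S hS)]
      ring
    have hAB : ∑ S ∈ (insert i s).powerset, 3 ^ S.card * a S ^ 2 = A + 3 * B := by
      rw [Finset.sum_powerset_insert hi, hA, hB, Finset.mul_sum]
      congr 1
      refine Finset.sum_congr rfl fun S hS => ?_
      rw [Finset.card_insert_of_notMem (hnot S hS)]
      ring
    have hFflip : ∀ x, F (flipAt i x) = F x := fun x =>
      Finset.sum_congr rfl fun S hS => by rw [walsh_flipAt_of_notMem i (hnot S hS)]
    have hGflip : ∀ x, G (flipAt i x) = G x := fun x =>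
      Finset.sum_congr rfl fun S hS => by rw [walsh_flipAt_of_notMem i (hnot S hS)]
    have hA0 : 0 ≤ A := Finset.sum_nonneg fun S _ => by positivity
    have hB0 : 0 ≤ B := Finset.sum_nonneg fun S _ => by positivity
    have hF4 : cubeExp (fun x => F x ^ 4) ≤ A ^ 2 := ih a
    have hG4 : cubeExp (fun x => G x ^ 4) ≤ B ^ 2 := ih fun S => a (insert i S)
    have hodd := cubeExp_bitSign_mul i (fun x => 4 * F x ^ 3 * G x + 4 * F x * G x ^ 3)
      fun x => by rw [hFflip, hGflip]
    have hexp : cubeExp (fun x => (F x + bitSign (x i) * G x) ^ 4) =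
        cubeExp (fun x => F x ^ 4) + cubeExp (fun x => G x ^ 4) +
          6 * cubeExp (fun x => F x ^ 2 * G x ^ 2) := by
      rw [← add_zero (_ + 6 * _), ← hodd, ← cubeExp_const_mul, ← cubeExp_add, ← cubeExp_add,
        ← cubeExp_add]
      congr 1
      funext x
      linear_combination
        (6 * F x ^ 2 * G x ^ 2 + 4 * F x * bitSign (x i) * G x ^ 3 +
          G x ^ 4 * (bitSign (x i) ^ 2 + 1)) * bitSign_sq (x i)
    have hcs : cubeExp (fun x => F x ^ 2 * G x ^ 2) ≤ A * B := by
      refine abs_le_of_sq_le_sq' ?_ (by positivity) |>.2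
      calc _ ≤ _ := cubeExp_mul_sq_le _ _
        _ = cubeExp (fun x => F x ^ 4) * cubeExp (fun x => G x ^ 4) := by
          simp only [← pow_mul]
        _ ≤ A ^ 2 * B ^ 2 :=
          mul_le_mul hF4 hG4 (cubeExp_nonneg _ fun x => by positivity) (by positivity)
        _ = (A * B) ^ 2 := by ring
    simp only [hFG]
    rw [hexp, hAB]
    nlinarith [sq_nonneg B]

/-- Hypercontractivity for functions with values in `{-1, 0, 1}`. -/
theorem sq_sum_inv_pow_walshCoeff_sq_le (g : (Fin N → Bool) → ℝ) (hg : ∀ x, g x ^ 3 = g x) :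
    (∑ S : Finset (Fin N), (3⁻¹ : ℝ) ^ S.card * walshCoeff g S ^ 2) ^ 2 ≤
      cubeExp (fun x => g x ^ 2) ^ 3 := by
  set q := ∑ S : Finset (Fin N), (3⁻¹ : ℝ) ^ S.card * walshCoeff g S ^ 2 with hq
  set p := cubeExp (fun x => g x ^ 2) with hp
  set h : (Fin N → Bool) → ℝ :=
    fun x => ∑ S : Finset (Fin N), ((3⁻¹ : ℝ) ^ S.card * walshCoeff g S) * walsh S x with hh
  have hp0 : 0 ≤ p := cubeExp_nonneg _ fun x => by positivity
  have hg4 : ∀ x, (g x ^ 2) ^ 2 = g x ^ 2 := fun x => by linear_combination g x * hg x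
  have h4 : cubeExp (fun x => h x ^ 4) ≤ q ^ 2 := by
    have := cubeExp_walsh_sum_pow_four_le Finset.univ
      fun S : Finset (Fin N) => (3⁻¹ : ℝ) ^ S.card * walshCoeff g S
    rw [Finset.powerset_univ] at this
    refine this.trans_eq ?_
    rw [hq]
    congr 1
    refine Finset.sum_congr rfl fun S _ => ?_
    have h3 : (3 : ℝ) ^ S.card * 3⁻¹ ^ S.card = 1 := by
      rw [← mul_pow]
      norm_num
    linear_combination (3⁻¹ : ℝ) ^ S.card * walshCoeff g S ^ 2 * h3
  have hgh : cubeExp (fun x => g x * (g x ^ 2 * h x)) = q := by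
    have : (fun x => g x * (g x ^ 2 * h x)) = fun x => ∑ S : Finset (Fin N),
        ((3⁻¹ : ℝ) ^ S.card * walshCoeff g S) * (g x * walsh S x) := by
      funext x
      rw [← mul_assoc, ← pow_succ', hg, hh, Finset.mul_sum]
      exact Finset.sum_congr rfl fun S _ => by ring
    rw [this, cubeExp_sum, hq]
    refine Finset.sum_congr rfl fun S _ => ?_
    rw [cubeExp_const_mul, ← walshCoeff]
    ring
  have hcs1 : q ^ 2 ≤ p * cubeExp (fun x => g x ^ 2 * h x ^ 2) := by
    have := cubeExp_mul_sq_le g fun x => g x ^ 2 * h x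
    simpa only [hgh, mul_pow, hg4] using this
  have hcs2 : cubeExp (fun x => g x ^ 2 * h x ^ 2) ^ 2 ≤ p * q ^ 2 := by
    have := cubeExp_mul_sq_le (fun x => g x ^ 2) fun x => h x ^ 2
    simp only [hg4, ← pow_mul (h _)] at this
    exact this.trans (mul_le_mul_of_nonneg_left h4 hp0)
  rcases (sq_nonneg q).eq_or_lt with h0 | h0
  · rw [← h0]
    positivity
  · refine le_of_mul_le_mul_right ?_ h0
    calc q ^ 2 * q ^ 2 = (q ^ 2) ^ 2 := by ring
      _ ≤ (p * cubeExp (fun x => g x ^ 2 * h x ^ 2)) ^ 2 := by gcongr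
      _ = p ^ 2 * cubeExp (fun x => g x ^ 2 * h x ^ 2) ^ 2 := by ring
      _ ≤ p ^ 2 * (p * q ^ 2) := by gcongr
      _ = p ^ 3 * q ^ 2 := by ring

theorem sum_walshCoeff_sq_div_card_le (g : (Fin N → Bool) → ℝ) (hg : ∀ x, g x ^ 3 = g x)
    (m : ℕ) :
    ∑ S : Finset (Fin N), walshCoeff g S ^ 2 / S.card ≤
      3 ^ m * (cubeExp (fun x => g x ^ 2) * √(cubeExp fun x => g x ^ 2)) +
        cubeExp (fun x => g x ^ 2) / (m + 1) := by
  have hp0 : 0 ≤ cubeExp (fun x => g x ^ 2) := cubeExp_nonneg _ fun x => by positivity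
  have hq := sq_sum_inv_pow_walshCoeff_sq_le g hg
  have hq' : ∑ S : Finset (Fin N), (3⁻¹ : ℝ) ^ S.card * walshCoeff g S ^ 2 ≤
      cubeExp (fun x => g x ^ 2) * √(cubeExp fun x => g x ^ 2) := by
    refine abs_le_of_sq_le_sq' (hq.trans_eq ?_) (by positivity) |>.2
    rw [mul_pow, Real.sq_sqrt hp0]
    ring
  refine le_trans ?_ (add_le_add_left (mul_le_mul_of_nonneg_left hq' (by positivity)) _)
  rw [← sum_walshCoeff_sq, Finset.mul_sum, Finset.sum_div, ← Finset.sum_add_distrib]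
  refine Finset.sum_le_sum fun S _ => ?_
  rcases le_or_gt S.card m with hS | hS
  · have h1 : walshCoeff g S ^ 2 / S.card ≤ walshCoeff g S ^ 2 := by
      rcases Nat.eq_zero_or_pos S.card with h0 | h0
      · simp [h0, sq_nonneg]
      · exact div_le_self (sq_nonneg _) (by exact_mod_cast h0)
    have h2 : (1 : ℝ) ≤ 3 ^ m * 3⁻¹ ^ S.card := by
      rw [inv_pow, ← div_eq_mul_inv, one_le_div (by positivity)]
      exact pow_le_pow_right₀ (by norm_num) hS
    have h3 : 0 ≤ walshCoeff g S ^ 2 / (m + 1) := by positivity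
    have h4 := mul_le_mul_of_nonneg_right h2 (sq_nonneg (walshCoeff g S))
    linarith
  · have h1 : walshCoeff g S ^ 2 / S.card ≤ walshCoeff g S ^ 2 / (m + 1) := by
      gcongr
      exact_mod_cast hS
    have h2 : 0 ≤ 3 ^ m * ((3⁻¹ : ℝ) ^ S.card * walshCoeff g S ^ 2) := by positivity
    linarith

theorem variance_eq_sum_flipDiff (f : (Fin N → Bool) → ℝ) :
    cubeExp (fun x => f x ^ 2) - cubeExp f ^ 2 =
      1 / 4 * ∑ i, ∑ S : Finset (Fin N), walshCoeff (flipDiff i f) S ^ 2 / S.card := by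
  have h0 : walshCoeff f ∅ = cubeExp f := by simp [walshCoeff, walsh]
  rw [Finset.sum_comm, ← sum_walshCoeff_sq, ← h0,
    ← Finset.add_sum_erase _ _ (Finset.mem_univ ∅), add_sub_cancel_left,
    ← Finset.add_sum_erase (a := ∅) _ _ (Finset.mem_univ ∅)]
  simp only [Finset.card_empty, Nat.cast_zero, div_zero, Finset.sum_const_zero, zero_add]
  rw [Finset.mul_sum]
  refine Finset.sum_congr rfl fun S hS => ?_
  have hS' : (S.card : ℝ) ≠ 0 := by
    simpa using Finset.ne_of_mem_erase hS
  simp only [walshCoeff_flipDiff, ite_pow, ite_div]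
  simp
  field_simp
  ring

end Fourier

theorem exists_three_pow_mul_sqrt_le {p : ℝ} (hp : 0 < p) (hp1 : p ≤ 1) :
    ∃ m : ℕ, 3 ^ m * (p * √p) + p / (m + 1) ≤ 7 * (p / (1 + Real.log (1 / √p))) := by
  set L := Real.log (1 / √p) with hL
  have hs : 0 < √p := Real.sqrt_pos.2 hp
  have hL0 : 0 ≤ L := Real.log_nonneg (by
    rw [le_div_iff₀ hs, one_mul]
    exact Real.sqrt_le_one.2 hp1)
  have hsL : √p = Real.exp (-L) := by
    rw [hL, one_div, Real.log_inv, neg_neg, Real.exp_log hs]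
  refine ⟨⌊L / 4⌋₊, ?_⟩
  have hm := Nat.floor_le (div_nonneg hL0 (by norm_num : (0 : ℝ) ≤ 4))
  have hm' := Nat.lt_floor_add_one (L / 4)
  set m := ⌊L / 4⌋₊
  have h3 : (3 : ℝ) ≤ Real.exp 2 := by
    have := Real.add_one_le_exp (2 : ℝ)
    linarith
  have h1 : (3 : ℝ) ^ m * √p ≤ 2 / (1 + L) := by
    calc (3 : ℝ) ^ m * √p ≤ Real.exp 2 ^ m * Real.exp (-L) := by
          rw [hsL]
          gcongr
      _ = Real.exp (m * 2 - L) := by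
          rw [← Real.exp_nat_mul, ← Real.exp_add, sub_eq_add_neg]
      _ ≤ Real.exp (-(L / 2)) := Real.exp_le_exp.2 (by linarith)
      _ = (Real.exp (L / 2))⁻¹ := Real.exp_neg _
      _ ≤ ((1 + L) / 2)⁻¹ := by
          gcongr
          have := Real.add_one_le_exp (L / 2)
          linarith
      _ = 2 / (1 + L) := inv_div _ _
  have h2 : 1 / ((m : ℝ) + 1) ≤ 5 / (1 + L) := by
    rw [div_le_div_iff₀ (by positivity) (by positivity)]
    have : (0 : ℝ) ≤ m := by positivity
    linarith
  calc 3 ^ m * (p * √p) + p / (m + 1) = p * (3 ^ m * √p + 1 / ((m : ℝ) + 1)) := by ring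
    _ ≤ p * (2 / (1 + L) + 5 / (1 + L)) := by gcongr
    _ = 7 * (p / (1 + L)) := by ring

section Indicator

variable {N : ℕ} (A : Finset (Fin N → Bool))

/-- The indicator function of `A`. -/
noncomputable def cubeInd (x : Fin N → Bool) : ℝ := if x ∈ A then 1 else 0

theorem cubeExp_cubeInd : cubeExp (cubeInd A) = cubeMeas N A := by
  simp [cubeExp, cubeInd, cubeMeas]

theorem cubeInd_sq (x : Fin N → Bool) : cubeInd A x ^ 2 = cubeInd A x := by
  unfold cubeInd
  split_ifs <;> norm_num

theorem flipDiff_cubeInd_pow_three (i : Fin N) (x : Fin N → Bool) :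
    flipDiff i (cubeInd A) x ^ 3 = flipDiff i (cubeInd A) x := by
  unfold flipDiff cubeInd
  split_ifs <;> norm_num

theorem cubeExp_flipDiff_cubeInd_sq (i : Fin N) :
    cubeExp (fun x => flipDiff i (cubeInd A) x ^ 2) = 2 * cubeInfl N i A := by
  have h : cubeExp (fun x => cubeInd A x * (1 - cubeInd A (flipAt i x))) = cubeInfl N i A := by
    have hx : ∀ x, cubeInd A x * (1 - cubeInd A (flipAt i x)) =
        if x ∈ A ∧ flipAt i x ∉ A then 1 else 0 := by
      intro x
      by_cases h1 : x ∈ A <;> by_cases h2 : flipAt i x ∈ A <;> simp [cubeInd, h1, h2]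
    simp only [cubeInfl, cubeExp, hx, Finset.sum_boole]
    congr 3
    ext x
    rw [Finset.mem_filter, Finset.mem_filter]
    simp [flipAt]
  have h' : cubeExp (fun x => cubeInd A (flipAt i x) * (1 - cubeInd A x)) = cubeInfl N i A := by
    rw [← h, ← cubeExp_comp_flipAt i]
    simp only [flipAt_flipAt]
  rw [two_mul]
  nth_rw 1 [← h]
  rw [← h', ← cubeExp_add]
  congr 1
  funext x
  rw [flipDiff]
  linear_combination cubeInd_sq A x + cubeInd_sq A (flipAt i x)

theorem two_mul_cubeInfl_le_one (i : Fin N) : 2 * cubeInfl N i A ≤ 1 := by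
  rw [← cubeExp_flipDiff_cubeInd_sq, cubeExp, div_le_one (by positivity)]
  calc ∑ x, flipDiff i (cubeInd A) x ^ 2 ≤ ∑ _x : Fin N → Bool, (1 : ℝ) := by
        refine Finset.sum_le_sum fun x _ => ?_
        unfold flipDiff cubeInd
        split_ifs <;> norm_num
    _ = 2 ^ N := by simp

end Indicator

/-- Talagrand's influence inequality on the discrete cube. -/
theorem stmt1 :
    ∃ C : ℝ, 1 ≤ C ∧ ∀ N : ℕ, 1 ≤ N → ∀ A : Finset (Fin N → Bool),
      cubeMeas N A * (1 - cubeMeas N A) ≤ C * ∑ i : Fin N,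
        if cubeInfl N i A = 0 then 0 else
          2 * cubeInfl N i A /
            (1 + Real.log (1 / Real.sqrt (2 * cubeInfl N i A))) := by
  refine ⟨7, by norm_num, fun N _ A => ?_⟩
  have hvar := variance_eq_sum_flipDiff (cubeInd A)
  rw [funext (cubeInd_sq A), cubeExp_cubeInd] at hvar
  have hterm : ∀ i, ∑ S : Finset (Fin N), walshCoeff (flipDiff i (cubeInd A)) S ^ 2 / S.card ≤
      7 * if cubeInfl N i A = 0 then 0 else
        2 * cubeInfl N i A / (1 + Real.log (1 / Real.sqrt (2 * cubeInfl N i A))) := by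
    intro i
    have hbound := sum_walshCoeff_sq_div_card_le _ (flipDiff_cubeInd_pow_three A i)
    simp only [cubeExp_flipDiff_cubeInd_sq] at hbound
    split_ifs with h0
    · simpa [h0] using hbound 0
    · have hI : 0 ≤ cubeInfl N i A := by
        unfold cubeInfl
        positivity
      obtain ⟨m, hm⟩ := exists_three_pow_mul_sqrt_le (p := 2 * cubeInfl N i A)
        (by positivity) (two_mul_cubeInfl_le_one A i)
      exact (hbound m).trans hm
  have hsum := Finset.sum_le_sum fun i (_ : i ∈ Finset.univ) => hterm i
  rw [← Finset.mul_sum] at hsum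
  have hnonneg : 0 ≤ ∑ i, ∑ S : Finset (Fin N),
      walshCoeff (flipDiff i (cubeInd A)) S ^ 2 / S.card :=
    Finset.sum_nonneg fun i _ => Finset.sum_nonneg fun S _ => by positivity
  linarith
end

section
/- There exists a numerical constant C ≥ 1 with the following property. Let G be a finite group with uniform probability measure μ, S ⊆ G a symmetric generating set with u S u^{−1} = S for all u ∈ S, and suppose ρ > 0 satisfies ρ Ent_μ(f²) ≤ 2·(1/(2|S|)) Σ_{s∈S} ‖D_s f‖₂² for all f : G → ℝ. Then for every A ⊆ G with μ(A) = a ∈ (0,1), there exists s ∈ S with I_s(A) ≥ (1/C) a(1−a) ρ log(1 + 1/(Cρ a(1−a))) ≥ (1/C) a(1−a) ρ log(1 + 1/(Cρ)). -/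
/-- Expectation with respect to the uniform probability measure on a finite group. -/
noncomputable def grpE (G : Type*) [Fintype G] (g : G → ℝ) : ℝ :=
  (∑ x : G, g x) / Fintype.card G

/-- `L²` norm squared with respect to the uniform probability measure. -/
noncomputable def grpNormSq (G : Type*) [Fintype G] (g : G → ℝ) : ℝ :=
  grpE G fun x => g x ^ 2

/-- Entropy with respect to the uniform probability measure. -/
noncomputable def grpEnt (G : Type*) [Fintype G] (g : G → ℝ) : ℝ :=
  grpE G (fun x => g x * Real.log (g x)) - grpE G g * Real.log (grpE G g)

/-- `D_s f (x) = f(sx) - f(x)`. -/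
def grpD (G : Type*) [Group G] (s : G) (f : G → ℝ) (x : G) : ℝ :=
  f (s * x) - f x

/-- Uniform measure of a subset of a finite group. -/
noncomputable def grpMeas (G : Type*) [Fintype G] (A : Finset G) : ℝ :=
  (A.card : ℝ) / Fintype.card G

/-- Influence of the direction `s` on `A`: `I_s(A) = μ({x : x ∈ A, sx ∉ A})`. -/
noncomputable def grpInfl (G : Type*) [Group G] [Fintype G] [DecidableEq G]
    (s : G) (A : Finset G) : ℝ :=
  ((A.filter fun x => s * x ∉ A).card : ℝ) / Fintype.card G

section Expectation

variable {G : Type*} [Fintype G]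

lemma grpE_add (g h : G → ℝ) : grpE G (fun x => g x + h x) = grpE G g + grpE G h := by
  simp only [grpE, Finset.sum_add_distrib, add_div]

lemma grpE_sub (g h : G → ℝ) : grpE G (fun x => g x - h x) = grpE G g - grpE G h := by
  simp only [grpE, Finset.sum_sub_distrib, sub_div]

lemma grpE_const_mul (c : ℝ) (g : G → ℝ) : grpE G (fun x => c * g x) = c * grpE G g := by
  simp only [grpE, ← Finset.mul_sum, mul_div_assoc]

lemma grpE_sum {ι : Type*} (S : Finset ι) (g : ι → G → ℝ) :
    grpE G (fun x => ∑ i ∈ S, g i x) = ∑ i ∈ S, grpE G (g i) := by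
  simp only [grpE, ← Finset.sum_div]
  rw [Finset.sum_comm]

lemma grpE_const [Nonempty G] (c : ℝ) : grpE G (fun _ => c) = c := by
  simp [grpE]

lemma grpE_mono {g h : G → ℝ} (hgh : ∀ x, g x ≤ h x) : grpE G g ≤ grpE G h :=
  div_le_div_of_nonneg_right (Finset.sum_le_sum fun x _ => hgh x) (Nat.cast_nonneg _)

lemma grpE_nonneg {g : G → ℝ} (hg : ∀ x, 0 ≤ g x) : 0 ≤ grpE G g :=
  div_nonneg (Finset.sum_nonneg fun x _ => hg x) (Nat.cast_nonneg _)

lemma grpE_mul_left [Group G] (s : G) (g : G → ℝ) : grpE G (fun x => g (s * x)) = grpE G g := by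
  simp only [grpE]
  congr 1
  exact Fintype.sum_equiv (Equiv.mulLeft s) _ _ fun _ => rfl

/-- A lower bound for the entropy of a square in terms of its `L²` and `L¹` norms. -/
lemma le_grpEnt_sq (K : ℝ) (g : G → ℝ) :
    (K + 1) * grpE G (fun x => g x ^ 2) - Real.exp K * grpE G (fun x => |g x|) ^ 2 ≤
      grpEnt G (fun x => g x ^ 2) := by
  set N := grpE G (fun x => g x ^ 2) with hN
  set M := grpE G (fun x => |g x|) with hM
  have hN0 : 0 ≤ N := grpE_nonneg fun x => sq_nonneg _
  rcases hN0.eq_or_lt with hz | hpos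
  · have hg : ∀ x, g x = 0 := by
      intro x
      have hcard : (0 : ℝ) < Fintype.card G := by exact_mod_cast Fintype.card_pos_iff.2 ⟨x⟩
      have hsum : ∑ x : G, g x ^ 2 = 0 := by
        have := hz.symm
        rw [hN, grpE, div_eq_zero_iff] at this
        exact this.resolve_right hcard.ne'
      have := (Finset.sum_eq_zero_iff_of_nonneg fun x _ => sq_nonneg (g x)).1 hsum x
        (Finset.mem_univ x)
      simpa using this
    simp [hM, ← hz, grpEnt, hg, grpE]
  · have hr : 0 < √N := Real.sqrt_pos.2 hpos
    set c := Real.exp (K / 2) * √N with hc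
    have hc0 : 0 < c := by positivity
    have hlogc : Real.log c = K / 2 + Real.log N / 2 := by
      rw [hc, Real.log_mul (Real.exp_pos _).ne' hr.ne', Real.log_exp, Real.log_sqrt hN0]
    have hpt : ∀ x, (2 + 2 * Real.log c) * g x ^ 2 - 2 * c * |g x| ≤
        g x ^ 2 * Real.log (g x ^ 2) := by
      intro x
      rcases eq_or_ne (g x) 0 with h0 | h0
      · simp [h0]
      · have ht : 0 < |g x| := abs_pos.2 h0
        have h1 := Real.log_le_sub_one_of_pos (div_pos hc0 ht)
        rw [Real.log_div hc0.ne' ht.ne'] at h1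
        have h2 := mul_le_mul_of_nonneg_left h1 (sq_nonneg |g x|)
        have h3 : |g x| ^ 2 * (c / |g x| - 1) = c * |g x| - |g x| ^ 2 := by
          field_simp
        rw [h3] at h2
        rw [← sq_abs (g x), Real.log_pow]
        push_cast
        linarith
    have hint := grpE_mono hpt
    rw [grpE_sub, grpE_const_mul, grpE_const_mul] at hint
    rw [← hN, ← hM, hlogc] at hint
    have hexp : Real.exp K = Real.exp (K / 2) ^ 2 := by
      rw [← Real.exp_nat_mul]; congr 1; push_cast; ring
    have hsq : √N ^ 2 = N := Real.sq_sqrt hN0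
    have hamgm := sq_nonneg (√N - Real.exp (K / 2) * M)
    have hcM : c * M = √N * (Real.exp (K / 2) * M) := by rw [hc]; ring
    simp only [grpEnt]
    rw [← hN, hexp]
    nlinarith

end Expectation

section Generator

variable {G : Type*} [Group G]

/-- The generator `b ∑_{s ∈ S} (1 - s)`, a nonnegative operator, of the random walk on `G` with
steps in `S` and rate `b`. -/
noncomputable def grpGen (b : ℝ) (S : Finset G) (g : G → ℝ) (x : G) : ℝ :=
  b * ∑ s ∈ S, (g x - g (s * x))

lemma grpGen_add (b : ℝ) (S : Finset G) (g h : G → ℝ) (x : G) :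
    grpGen b S (fun y => g y + h y) x = grpGen b S g x + grpGen b S h x := by
  simp only [grpGen, ← mul_add, ← Finset.sum_add_distrib]
  congr 1
  exact Finset.sum_congr rfl fun s _ => by ring

lemma grpGen_const_mul (b : ℝ) (S : Finset G) (c : ℝ) (g : G → ℝ) (x : G) :
    grpGen b S (fun y => c * g y) x = c * grpGen b S g x := by
  simp only [grpGen, ← mul_sub, ← Finset.mul_sum]
  ring

/-- The generator commutes with the derivative in a direction normalizing `S`. -/
lemma grpGen_grpD (b : ℝ) (S : Finset G) {u : G} (hu : ∀ s ∈ S, u * s * u⁻¹ ∈ S)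
    (g : G → ℝ) (x : G) :
    grpGen b S (grpD G u g) x = grpD G u (grpGen b S g) x := by
  classical
  have himg : S.image (fun s => u * s * u⁻¹) = S := by
    refine Finset.eq_of_subset_of_card_le (Finset.image_subset_iff.2 hu) ?_
    rw [Finset.card_image_of_injective]
    intro s t hst
    simpa using hst
  have hsum : ∑ s ∈ S, g (s * (u * x)) = ∑ s ∈ S, g (u * (s * x)) := by
    conv_lhs => rw [← himg]
    rw [Finset.sum_image fun s _ t _ hst => by simpa using hst]
    exact Finset.sum_congr rfl fun s _ => by congr 1; group
  simp only [grpGen, grpD, Finset.sum_sub_distrib, hsum]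
  ring

variable [Fintype G]

lemma sum_grpE_grpD_mul (b : ℝ) (S : Finset G) (g h : G → ℝ) :
    b * ∑ s ∈ S, grpE G (fun x => grpD G s g x * grpD G s h x) =
      grpE G (fun x => grpGen b S g x * h x) + grpE G (fun x => g x * grpGen b S h x) := by
  have h1 : ∀ s, grpE G (fun x => grpD G s g x * grpD G s h x) =
      grpE G (fun x => (g x - g (s * x)) * h x) + grpE G (fun x => g x * (h x - h (s * x))) := by
    intro s
    have h2 := grpE_mul_left s (fun x => g x * h x)
    rw [← sub_eq_zero, ← grpE_sub] at h2
    rw [← sub_eq_zero, ← grpE_add, ← grpE_sub, ← h2]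
    congr 1
    ext x
    simp only [grpD]
    ring
  rw [← grpE_add]
  simp only [h1, ← grpE_add]
  rw [← grpE_sum, ← grpE_const_mul]
  congr 1
  ext x
  simp only [grpGen, Finset.sum_add_distrib, ← Finset.sum_mul, ← Finset.mul_sum]
  ring

lemma grpE_grpGen_mul_comm (b : ℝ) {S : Finset G} (hS : ∀ s ∈ S, s⁻¹ ∈ S) (g h : G → ℝ) :
    grpE G (fun x => grpGen b S g x * h x) = grpE G (fun x => g x * grpGen b S h x) := by
  have hshift : ∀ s, grpE G (fun x => g (s * x) * h x) = grpE G (fun x => g x * h (s⁻¹ * x)) := by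
    intro s
    rw [← grpE_mul_left s fun x => g x * h (s⁻¹ * x)]
    simp
  have hinv : ∑ s ∈ S, grpE G (fun x => g x * h (s⁻¹ * x)) =
      ∑ s ∈ S, grpE G (fun x => g x * h (s * x)) :=
    Finset.sum_nbij' (·⁻¹) (·⁻¹) hS hS (by simp) (by simp) (by simp)
  have hl : ∀ x, grpGen b S g x * h x =
      b * ∑ s ∈ S, (g x * h x - g (s * x) * h x) := by
    intro x
    simp only [grpGen, ← sub_mul, ← Finset.sum_mul]
    ring
  have hr : ∀ x, g x * grpGen b S h x =
      b * ∑ s ∈ S, (g x * h x - g x * h (s * x)) := by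
    intro x
    simp only [grpGen, ← mul_sub, ← Finset.mul_sum]
    ring
  simp only [hl, hr, grpE_const_mul, grpE_sum, grpE_sub, Finset.sum_sub_distrib, hshift, hinv]

lemma two_mul_grpE_grpGen_mul (b : ℝ) (S : Finset G) (g : G → ℝ) :
    2 * grpE G (fun x => grpGen b S g x * g x) =
      b * ∑ s ∈ S, grpE G (fun x => grpD G s g x ^ 2) := by
  have h := sum_grpE_grpD_mul b S g g
  simp only [← sq] at h
  rw [h, two_mul]
  simp only [mul_comm]

lemma grpE_grpGen_mul_nonneg {b : ℝ} (hb : 0 ≤ b) (S : Finset G) (g : G → ℝ) :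
    0 ≤ grpE G (fun x => grpGen b S g x * g x) := by
  have h := two_mul_grpE_grpGen_mul b S g
  have : 0 ≤ b * ∑ s ∈ S, grpE G (fun x => grpD G s g x ^ 2) :=
    mul_nonneg hb (Finset.sum_nonneg fun s _ => grpE_nonneg fun x => sq_nonneg _)
  linarith

lemma grpE_grpGen (b : ℝ) (S : Finset G) (g : G → ℝ) : grpE G (grpGen b S g) = 0 := by
  have : grpGen b S g = fun x => b * ∑ s ∈ S, (g x - g (s * x)) := rfl
  simp [this, grpE_const_mul, grpE_sum, grpE_sub, grpE_mul_left]

/-- The resolvent of the generator contracts the `L¹` norm. -/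
lemma grpE_abs_le_grpE_abs_add_grpGen {b : ℝ} (hb : 0 ≤ b) (S : Finset G) (g : G → ℝ) :
    grpE G (fun x => |g x|) ≤ grpE G (fun x => |g x + grpGen b S g x|) := by
  have hpt : ∀ x, |g x| + b * ∑ s ∈ S, (|g x| - |g (s * x)|) ≤ |g x + grpGen b S g x| := by
    intro x
    have h1 : (1 + b * S.card) * g x = (g x + grpGen b S g x) + b * ∑ s ∈ S, g (s * x) := by
      simp only [grpGen, Finset.sum_sub_distrib, Finset.sum_const, nsmul_eq_mul]
      ring
    have h2 : |(1 + b * S.card) * g x| ≤ |g x + grpGen b S g x| + b * ∑ s ∈ S, |g (s * x)| := by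
      rw [h1]
      refine (abs_add_le _ _).trans (add_le_add le_rfl ?_)
      rw [abs_mul, abs_of_nonneg hb]
      exact mul_le_mul_of_nonneg_left (Finset.abs_sum_le_sum_abs _ _) hb
    rw [abs_mul, abs_of_nonneg (by positivity)] at h2
    simp only [Finset.sum_sub_distrib, Finset.sum_const, nsmul_eq_mul]
    linarith
  have h := grpE_mono hpt
  have h0 := grpE_grpGen b S fun x => |g x|
  rw [grpE_add] at h
  change _ + grpE G (grpGen b S fun x => |g x|) ≤ _ at h
  linarith

lemma exists_add_grpGen_eq {b : ℝ} (hb : 0 ≤ b) (S : Finset G) (f : G → ℝ) :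
    ∃ h : G → ℝ, ∀ x, h x + grpGen b S h x = f x := by
  let T : (G → ℝ) →ₗ[ℝ] (G → ℝ) :=
    { toFun := fun g x => g x + grpGen b S g x
      map_add' := fun g h => by
        ext x
        have := grpGen_add b S g h x
        change (g x + h x) + grpGen b S (fun y => g y + h y) x =
          (g x + grpGen b S g x) + (h x + grpGen b S h x)
        rw [this]; ring
      map_smul' := fun c g => by
        ext x
        have := grpGen_const_mul b S c g x
        change c * g x + grpGen b S (fun y => c * g y) x = c * (g x + grpGen b S g x)
        rw [this]; ring }
  have hinj : Function.Injective T := by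
    rw [← LinearMap.ker_eq_bot, LinearMap.ker_eq_bot']
    intro g hg
    have hg' : ∀ x, g x + grpGen b S g x = 0 := fun x => congrFun hg x
    have h := grpE_abs_le_grpE_abs_add_grpGen hb S g
    simp only [hg', abs_zero, grpE_const] at h
    have hcard : (0 : ℝ) < Fintype.card G := by exact_mod_cast Fintype.card_pos
    have hsum : ∑ x, |g x| = 0 := by
      refine le_antisymm ?_ (Finset.sum_nonneg fun x _ => abs_nonneg _)
      simpa using (div_le_iff₀ hcard).1 h
    ext x
    simpa using (Finset.sum_eq_zero_iff_of_nonneg fun x _ => abs_nonneg (g x)).1 hsum x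
      (Finset.mem_univ x)
  obtain ⟨h, hh⟩ := LinearMap.surjective_of_injective hinj f
  exact ⟨h, fun x => congrFun hh x⟩

lemma poincare_of_logSobolev {b : ℝ} {S : Finset G}
    (hLS : ∀ g : G → ℝ, grpEnt G (fun x => g x ^ 2) ≤ 2 * grpE G (fun x => grpGen b S g x * g x))
    {g : G → ℝ} (hg : grpE G g = 0) :
    grpE G (fun x => g x ^ 2) ≤ 2 * grpE G (fun x => grpGen b S g x * g x) := by
  set c := ∑ x, |g x| with hc
  have hpos : ∀ x, 0 ≤ g x + c := by
    intro x
    have h1 : |g x| ≤ c := Finset.single_le_sum (f := fun x => |g x|) (fun x _ => abs_nonneg _)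
      (Finset.mem_univ x)
    linarith [neg_abs_le (g x)]
  have h1 := le_grpEnt_sq 0 (fun x => g x + c)
  have h2 := hLS (fun x => g x + c)
  have hgen : ∀ x, grpGen b S (fun x => g x + c) x = grpGen b S g x := by
    intro x; simp [grpGen]
  have habs : grpE G (fun x => |g x + c|) = c := by
    simp only [abs_of_nonneg (hpos _)]
    rw [grpE_add, hg, grpE_const, zero_add]
  have hsq : grpE G (fun x => (g x + c) ^ 2) = grpE G (fun x => g x ^ 2) + c ^ 2 := by
    have : ∀ x, (g x + c) ^ 2 = g x ^ 2 + (2 * c * g x + c ^ 2) := fun x => by ring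
    simp only [this]
    rw [grpE_add, grpE_add, grpE_const_mul, hg, grpE_const]
    ring
  have hmul : grpE G (fun x => grpGen b S g x * (g x + c)) =
      grpE G (fun x => grpGen b S g x * g x) := by
    have : ∀ x, grpGen b S g x * (g x + c) = grpGen b S g x * g x + c * grpGen b S g x :=
      fun x => by ring
    simp only [this]
    rw [grpE_add, grpE_const_mul, grpE_grpGen]
    ring
  simp only [hgen] at h2
  rw [hmul] at h2
  rw [habs, hsq, Real.exp_zero] at h1
  linarith

/-- If `g` is centred and all its derivatives in directions of `S` have `L¹` norm at most `m`,
then the log-Sobolev inequality improves the Poincaré inequality by a factor `K`, up to an error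
of order `exp K * m ^ 2`. -/
lemma grpE_sq_le_of_logSobolev {b : ℝ} (hb : 0 ≤ b) {S : Finset G} (hS : ∀ s ∈ S, s⁻¹ ∈ S)
    (hconj : ∀ u ∈ S, ∀ s ∈ S, u * s * u⁻¹ ∈ S)
    (hLS : ∀ g : G → ℝ, grpEnt G (fun x => g x ^ 2) ≤ 2 * grpE G (fun x => grpGen b S g x * g x))
    {f : G → ℝ} (hf : grpE G f = 0) {m : ℝ} (hm : ∀ s ∈ S, grpE G (fun x => |grpD G s f x|) ≤ m)
    {K : ℝ} (hK : 16 ≤ K) :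
    grpE G (fun x => f x ^ 2) ≤ 4 / K * grpE G (fun x => grpGen b S f x * f x) +
      b * S.card * (Real.exp K * m ^ 2) / 4 := by
  obtain ⟨h, hh⟩ := exists_add_grpGen_eq hb S f
  obtain rfl : f = fun x => h x + grpGen b S h x := funext fun x => (hh x).symm
  have hh0 : grpE G h = 0 := by
    rw [grpE_add, grpE_grpGen, add_zero] at hf
    exact hf
  set τh := grpGen b S h with hτh
  set M0 := grpE G (fun x => h x ^ 2) with hM0
  set M1 := grpE G (fun x => τh x * h x) with hM1
  set M2 := grpE G (fun x => τh x ^ 2) with hM2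
  set M3 := grpE G (fun x => grpGen b S τh x * τh x) with hM3
  have hM2' : grpE G (fun x => grpGen b S τh x * h x) = M2 := by
    rw [grpE_grpGen_mul_comm b hS, ← hτh]
    simp only [hM2, sq]
  have hP : M0 ≤ 2 * M1 := poincare_of_logSobolev hLS hh0
  have hM1_nonneg : 0 ≤ M1 := grpE_grpGen_mul_nonneg hb S h
  have hM2_nonneg : 0 ≤ M2 := grpE_nonneg fun x => sq_nonneg _
  have hquad : ∀ p q : ℝ, grpE G (fun x => grpGen b S (fun y => p * h y + q * τh y) x *
      (p * h x + q * τh x)) = p ^ 2 * M1 + 2 * p * q * M2 + q ^ 2 * M3 := by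
    intro p q
    have : ∀ x, grpGen b S (fun y => p * h y + q * τh y) x * (p * h x + q * τh x) =
        p ^ 2 * (τh x * h x) + (p * q * τh x ^ 2 + (p * q * (grpGen b S τh x * h x) +
          q ^ 2 * (grpGen b S τh x * τh x))) := by
      intro x
      rw [grpGen_add b S (fun y => p * h y) (fun y => q * τh y), grpGen_const_mul,
        grpGen_const_mul, ← hτh]
      ring
    simp only [this]
    rw [grpE_add, grpE_add, grpE_add, grpE_const_mul, grpE_const_mul, grpE_const_mul,
      grpE_const_mul, hM2']
    ring
  have hsq : grpE G (fun x => (h x + τh x) ^ 2) = M0 + 2 * M1 + M2 := by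
    have : ∀ x, (h x + τh x) ^ 2 = h x ^ 2 + (2 * (τh x * h x) + τh x ^ 2) := fun x => by ring
    simp only [this]
    rw [grpE_add, grpE_add, grpE_const_mul]
    ring
  have henergy : grpE G (fun x => grpGen b S (fun y => h y + τh y) x * (h x + τh x)) =
      M1 + 2 * M2 + M3 := by
    have := hquad 1 1
    simp only [one_mul] at this
    rw [this]
    ring
  have hcs : 0 ≤ (K / 4) ^ 2 * M1 - K / 2 * M2 + M3 := by
    have h1 := hquad (-(K / 4)) 1
    have h2 := grpE_grpGen_mul_nonneg hb S (fun y => -(K / 4) * h y + 1 * τh y)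
    rw [h1] at h2
    linarith
  have hlog : K * M1 / 2 - M2 ≤ b * S.card * (Real.exp K * m ^ 2) / 4 := by
    have hs : ∀ s ∈ S, K * grpE G (fun x => grpD G s h x ^ 2) - Real.exp K * m ^ 2 ≤
        2 * grpE G (fun x => grpD G s τh x * grpD G s h x) := by
      intro s hs
      have h1 := le_grpEnt_sq K (grpD G s h)
      have h2 := hLS (grpD G s h)
      simp only [grpGen_grpD b S (hconj s hs), ← hτh] at h2
      have h3 : grpE G (fun x => |grpD G s h x|) ≤ m := by
        refine (grpE_abs_le_grpE_abs_add_grpGen hb S _).trans (le_of_eq_of_le ?_ (hm s hs))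
        congr 1
        ext x
        rw [grpGen_grpD b S (hconj s hs), ← hτh]
        simp only [grpD]
        congr 1
        ring
      have h4 : grpE G (fun x => |grpD G s h x|) ^ 2 ≤ m ^ 2 :=
        pow_le_pow_left₀ (grpE_nonneg fun x => abs_nonneg _) h3 2
      have h5 := mul_le_mul_of_nonneg_left h4 (Real.exp_pos K).le
      have h6 : 0 ≤ grpE G (fun x => grpD G s h x ^ 2) := grpE_nonneg fun x => sq_nonneg _
      linarith
    have hsum := mul_le_mul_of_nonneg_left (Finset.sum_le_sum hs) hb
    rw [Finset.sum_sub_distrib, ← Finset.mul_sum, Finset.sum_const, nsmul_eq_mul] at hsum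
    have hD1 := two_mul_grpE_grpGen_mul b S h
    have hD2 := sum_grpE_grpD_mul b S τh h
    simp only [← hτh, hM2', ← sq, ← hM1, ← hM2] at hD1 hD2
    rw [← Finset.mul_sum] at hsum
    linear_combination hsum / 4 + K / 4 * hD1 + hD2 / 2
  rw [hsq, henergy]
  have hKpos : 0 < K := by linarith
  have hcs' : 2 * M2 - K / 4 * M1 ≤ 4 / K * M3 := by
    rw [div_mul_eq_mul_div 4 K M3, le_div_iff₀ hKpos]
    linear_combination 4 * hcs
  have h4K : 0 ≤ 4 / K * (M1 + 2 * M2) := by positivity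
  nlinarith

end Generator

section Indicator

variable {G : Type*} [Fintype G] [DecidableEq G]

lemma grpE_indicator (A : Finset G) : grpE G (fun x => if x ∈ A then 1 else 0) = grpMeas G A := by
  simp [grpE, grpMeas]

lemma grpE_sq_indicator_sub [Nonempty G] (A : Finset G) :
    grpE G (fun x => ((if x ∈ A then 1 else 0) - grpMeas G A) ^ 2) =
      grpMeas G A * (1 - grpMeas G A) := by
  set a := grpMeas G A with ha
  have : ∀ x, ((if x ∈ A then 1 else 0) - a) ^ 2 =
      (1 - 2 * a) * (if x ∈ A then 1 else 0) + a ^ 2 := by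
    intro x
    by_cases h : x ∈ A <;> simp [h]
    ring
  simp only [this]
  rw [grpE_add, grpE_const_mul, grpE_indicator, grpE_const, ← ha]
  ring

variable [Group G]

lemma grpE_abs_grpD_indicator (s : G) (A : Finset G) (c : ℝ) :
    grpE G (fun x => |grpD G s (fun y => (if y ∈ A then 1 else 0) - c) x|) = 2 * grpInfl G s A := by
  have hI : grpInfl G s A = grpE G (fun x => if x ∈ A ∧ s * x ∉ A then 1 else 0) := by
    simp only [grpInfl, grpE, ← Finset.filter_filter, Finset.sum_boole, Finset.filter_univ_mem]
  have hpt : ∀ x, |grpD G s (fun y => (if y ∈ A then 1 else 0) - c) x| =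
      2 * (if x ∈ A ∧ s * x ∉ A then 1 else 0) +
        ((if s * x ∈ A then 1 else 0) - (if x ∈ A then 1 else 0)) := by
    intro x
    rw [grpD, sub_sub_sub_cancel_right]
    by_cases h1 : x ∈ A <;> by_cases h2 : s * x ∈ A <;> norm_num [h1, h2]
  simp only [hpt]
  rw [grpE_add, grpE_const_mul, grpE_sub, grpE_mul_left s fun x => if x ∈ A then (1 : ℝ) else 0,
    ← hI]
  ring

lemma grpE_sq_grpD_indicator (s : G) (A : Finset G) (c : ℝ) :
    grpE G (fun x => grpD G s (fun y => (if y ∈ A then 1 else 0) - c) x ^ 2) =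
      2 * grpInfl G s A := by
  rw [← grpE_abs_grpD_indicator s A c]
  congr 1
  ext x
  rw [grpD, sub_sub_sub_cancel_right]
  by_cases h1 : x ∈ A <;> by_cases h2 : s * x ∈ A <;> simp [h1, h2]

end Indicator

/-- A level `B` bounding all influences, for which `w ≤ 4 * B / K + exp K * B ^ 2` for all
`K ≥ 16`, cannot be as small as `w / 64 * log (1 + 1 / (64 * w))`. -/
lemma not_le_four_mul_div_add_exp_mul_sq {w : ℝ} (hw : 0 < w) {B : ℝ}
    (hB : B = w / 64 * Real.log (1 + 1 / (64 * w))) (h1 : w ≤ 2 * B)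
    (h2 : ∀ K : ℝ, 16 ≤ K → w ≤ 4 * B / K + Real.exp K * B ^ 2) : False := by
  set l := Real.log (1 + 1 / (64 * w)) with hl
  have hl32 : 32 ≤ l := by
    by_contra! hlt
    nlinarith
  have hexp : Real.exp l = 1 + 1 / (64 * w) := Real.exp_log (by positivity)
  have hhalf : Real.exp (l / 2) ^ 2 = Real.exp l := by
    rw [← Real.exp_nat_mul]; congr 1; push_cast; ring
  set y := Real.exp (l / 2) with hy
  have hy0 : 0 < y := Real.exp_pos _
  have hly : l ^ 2 ≤ 8 * y := by
    have := Real.quadratic_le_exp_of_nonneg (x := l / 2) (by linarith)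
    nlinarith
  have hwy : 64 * w * (y ^ 2 - 1) = 1 := by
    rw [hhalf, hexp]
    field_simp
    ring
  have hy2 : 2 ≤ y ^ 2 := by
    have := Real.add_one_le_exp l
    linarith
  have hwy2 : w * y ^ 2 ≤ 1 / 32 := by nlinarith
  have h := h2 (l / 2) (by linarith)
  have hfirst : 4 * B / (l / 2) = w / 8 := by
    rw [hB]
    field_simp
    norm_num
  have hsecond : y * B ^ 2 ≤ w / 8 := by
    have e : y * B ^ 2 = w * (w * y * l ^ 2) / 4096 := by rw [hB]; ring
    have h3 : w * y * l ^ 2 ≤ w * y * (8 * y) := mul_le_mul_of_nonneg_left hly (by positivity)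
    have h4 : w * y * l ^ 2 ≤ 1 := by nlinarith
    rw [e]
    nlinarith
  linarith

/-- Influences on a finite group with a conjugacy-stable symmetric generating set. -/
theorem stmt7 :
    ∃ C : ℝ, 1 ≤ C ∧
      ∀ (G : Type) [Group G] [Fintype G] [DecidableEq G] (S : Finset G),
      (∀ s ∈ S, s⁻¹ ∈ S) →
      Subgroup.closure (S : Set G) = ⊤ →
      (∀ u ∈ S, ∀ s ∈ S, u * s * u⁻¹ ∈ S) →
      ∀ ρ : ℝ, 0 < ρ →
      (∀ f : G → ℝ,
        ρ * grpEnt G (fun x => f x ^ 2) ≤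
          2 * ((1 / (2 * (S.card : ℝ))) * ∑ s ∈ S, grpNormSq G (grpD G s f))) →
      ∀ A : Finset G, ∀ a : ℝ, grpMeas G A = a → 0 < a → a < 1 →
      ∃ s ∈ S,
        grpInfl G s A ≥
          (1 / C) * (a * (1 - a)) * ρ * Real.log (1 + 1 / (C * ρ * (a * (1 - a)))) ∧
        (1 / C) * (a * (1 - a)) * ρ * Real.log (1 + 1 / (C * ρ * (a * (1 - a)))) ≥
          (1 / C) * (a * (1 - a)) * ρ * Real.log (1 + 1 / (C * ρ)) := by
  refine ⟨64, by norm_num, ?_⟩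
  intro G _ _ _ S hS _ hconj ρ hρ hLS A a ha ha0 ha1
  have hv : 0 < a * (1 - a) := mul_pos ha0 (by linarith)
  have hv1 : a * (1 - a) ≤ 1 := by nlinarith
  set B := (1 / 64) * (a * (1 - a)) * ρ * Real.log (1 + 1 / (64 * ρ * (a * (1 - a)))) with hB
  have hlog : 0 ≤ Real.log (1 + 1 / (64 * ρ * (a * (1 - a)))) :=
    Real.log_nonneg (le_add_of_nonneg_right (by positivity))
  have hB0 : 0 ≤ B := by positivity
  have hmono : B ≥ (1 / 64) * (a * (1 - a)) * ρ * Real.log (1 + 1 / (64 * ρ)) := by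
    refine mul_le_mul_of_nonneg_left (Real.log_le_log (by positivity) ?_) (by positivity)
    have : 64 * ρ * (a * (1 - a)) ≤ 64 * ρ := mul_le_of_le_one_right (by positivity) hv1
    gcongr
  suffices h : ∃ s ∈ S, B ≤ grpInfl G s A by
    obtain ⟨s, hs, h⟩ := h
    exact ⟨s, hs, h, hmono⟩
  by_contra! hlt
  set b := 1 / (ρ * S.card) with hb
  have hb0 : 0 ≤ b := by positivity
  have hbS : b * S.card ≤ 1 / ρ := by
    rcases Nat.eq_zero_or_pos S.card with h | h
    · simp [h, hρ.le]
    · have : (0 : ℝ) < S.card := by exact_mod_cast h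
      rw [hb]
      apply le_of_eq
      field_simp
  have hLS' : ∀ g : G → ℝ, grpEnt G (fun x => g x ^ 2) ≤
      2 * grpE G (fun x => grpGen b S g x * g x) := by
    intro g
    rw [two_mul_grpE_grpGen_mul]
    refine le_of_mul_le_mul_left ((hLS g).trans (le_of_eq ?_)) hρ
    simp only [hb, grpNormSq]
    field_simp
  set f : G → ℝ := fun x => (if x ∈ A then 1 else 0) - a with hf
  have hf0 : grpE G f = 0 := by
    rw [hf, grpE_sub, grpE_indicator, grpE_const, ha, sub_self]
  have hfsq : grpE G (fun x => f x ^ 2) = a * (1 - a) := by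
    have := grpE_sq_indicator_sub A
    rwa [ha] at this
  have hm : ∀ s ∈ S, grpE G (fun x => |grpD G s f x|) ≤ 2 * B := by
    intro s hs
    rw [hf, grpE_abs_grpD_indicator]
    linarith [hlt s hs]
  have henergy : grpE G (fun x => grpGen b S f x * f x) ≤ B / ρ := by
    have h1 := two_mul_grpE_grpGen_mul b S f
    have h2 : ∑ s ∈ S, grpE G (fun x => grpD G s f x ^ 2) ≤ S.card * (2 * B) := by
      rw [← nsmul_eq_mul]
      refine Finset.sum_le_card_nsmul _ _ _ fun s hs => ?_
      rw [hf, grpE_sq_grpD_indicator]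
      linarith [hlt s hs]
    have h3 := mul_le_mul_of_nonneg_left h2 hb0
    have h4 := mul_le_mul_of_nonneg_right hbS hB0
    have h5 : 1 / ρ * B = B / ρ := by ring
    linarith
  have hP := poincare_of_logSobolev hLS' hf0
  rw [hfsq] at hP
  refine not_le_four_mul_div_add_exp_mul_sq (w := ρ * (a * (1 - a))) (B := B) (by positivity)
    ?_ ?_ ?_
  · rw [hB, ← mul_assoc 64 ρ]
    ring
  · have h1 : ρ * (a * (1 - a)) ≤ ρ * (2 * (B / ρ)) :=
      mul_le_mul_of_nonneg_left (by linarith) hρ.le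
    have h2 : ρ * (2 * (B / ρ)) = 2 * B := by field_simp
    linarith
  · intro K hK
    have hKpos : 0 < K := by linarith
    have h := grpE_sq_le_of_logSobolev hb0 hS hconj hLS' hf0 hm hK
    rw [hfsq] at h
    have h1 : 4 / K * grpE G (fun x => grpGen b S f x * f x) ≤ 4 / K * (B / ρ) :=
      mul_le_mul_of_nonneg_left henergy (by positivity)
    have h2 : b * S.card * (Real.exp K * (2 * B) ^ 2) ≤ 1 / ρ * (Real.exp K * (2 * B) ^ 2) :=
      mul_le_mul_of_nonneg_right hbS (by positivity)
    have h3 : ρ * (a * (1 - a)) ≤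
        ρ * (4 / K * (B / ρ) + 1 / ρ * (Real.exp K * (2 * B) ^ 2) / 4) :=
      mul_le_mul_of_nonneg_left (by linarith) hρ.le
    refine h3.trans (le_of_eq ?_)
    field_simp
    ring
end
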